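/- For every state σ of the high-bay-warehouse DSL with σ ≠ Wrong, evaluating the protocol term spec from σ never reaches the error state: ⟨spec, σ⟩ ↝̸ Wrong, i.e., there is no evaluation sequence ⟨spec, σ⟩ →_IC … →_IC ⟨Skip, Wrong⟩. -/

import Mathlib

/-- Colors of items (and `empty` for an empty bay). -/
inductive Color
  | empty | red | white | blue
deriving DecidableEq, Repr

/-- The high-bay warehouse: a record of nine bays, each holding a color. -/
structure Bays where
  bay1 : Color
  bay2 : Color
  bay3 : Color
  bay4 : Color
  bay5 : Color
  bay6 : Color
  bay7 : Color
  bay8 : Color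
  bay9 : Color
deriving DecidableEq, Repr

/-- `bf b n` returns the color of bay `n` (for `1 ≤ n ≤ 9`). -/
def bf (b : Bays) : ℕ → Color
  | 1 => b.bay1
  | 2 => b.bay2
  | 3 => b.bay3
  | 4 => b.bay4
  | 5 => b.bay5
  | 6 => b.bay6
  | 7 => b.bay7
  | 8 => b.bay8
  | 9 => b.bay9
  | _ => Color.empty

/-- Update bay `n` to hold color `c`. -/
def setBay (b : Bays) (n : ℕ) (c : Color) : Bays :=
  match n with
  | 1 => { b with bay1 := c }
  | 2 => { b with bay2 := c }
  | 3 => { b with bay3 := c }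
  | 4 => { b with bay4 := c }
  | 5 => { b with bay5 := c }
  | 6 => { b with bay6 := c }
  | 7 => { b with bay7 := c }
  | 8 => { b with bay8 := c }
  | 9 => { b with bay9 := c }
  | _ => b

/-- `findColor c n b` returns the least index `m` with `n ≤ m ≤ 9` and `bf b m = c`,
or `none` if no such index exists. -/
def findColor (c : Color) (n : ℕ) (b : Bays) : Option ℕ :=
  if _h : n ≤ 9 then
    if bf b n = c then some n else findColor c (n + 1) b
  else none
termination_by 10 - n
decreasing_by omega

/-- User inputs: a request to retrieve or store an item of a given color. -/
inductive Input
  | RetrieveRequest (c : Color)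
  | StoreRequest (c : Color)
deriving DecidableEq, Repr

/-- The color requested by an input. -/
def requestedColor : Input → Color
  | .RetrieveRequest c => c
  | .StoreRequest c => c

/-- A state is either a valid state `⟨bays, input⟩` or the error state `Wrong`. -/
inductive State
  | Sigma (b : Bays) (i : Input)
  | Wrong
deriving DecidableEq, Repr

/-- External commands (RPCs). -/
inductive ExtCom
  | IsFull | NotFull | HasColor | DoesNotHaveColor
  | Store (c : Color)
  | Retrieve (c : Color)
deriving DecidableEq, Repr

/-- Atomic propositions. -/
inductive AP
  | APHasStoreRequest | APHasRetrieveRequest | APBaysFull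
  | APRequestRed | APRequestWhite | APRequestBlue
  | APContainsRed | APContainsWhite | APContainsBlue
deriving DecidableEq, Repr

/-- Internal commands of the DSL. -/
inductive IntCom
  | Skip
  | Seq (t1 t2 : IntCom)
  | If (p : AP) (t1 t2 : IntCom)
  | Ext (e : ExtCom)
deriving DecidableEq, Repr

/-- All nine bays are nonempty. -/
def baysFullB (b : Bays) : Bool :=
  (List.range' 1 9).all fun n => !(bf b n == Color.empty)

/-- Some bay holds color `c`. -/
def containsC (b : Bays) (c : Color) : Bool :=
  (List.range' 1 9).any fun n => bf b n == c

/-- Evaluation of an atomic proposition in a valid state `⟨b, i⟩`. -/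
def evalAP (p : AP) (b : Bays) (i : Input) : Bool :=
  match p with
  | .APHasStoreRequest => (match i with | .StoreRequest _ => true | _ => false)
  | .APHasRetrieveRequest => (match i with | .RetrieveRequest _ => true | _ => false)
  | .APBaysFull => baysFullB b
  | .APRequestRed => requestedColor i = Color.red
  | .APRequestWhite => requestedColor i = Color.white
  | .APRequestBlue => requestedColor i = Color.blue
  | .APContainsRed => containsC b Color.red
  | .APContainsWhite => containsC b Color.white
  | .APContainsBlue => containsC b Color.blue

/-- Evaluation of an atomic proposition in a state (no proposition holds at `Wrong`). -/
def evalAtomicProp (p : AP) : State → Bool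
  | .Sigma b i => evalAP p b i
  | .Wrong => false

/-- The labeling function `L : State → 2^AP`. -/
def labelFn (st : State) : Set AP := {p | evalAtomicProp p st = true}

/-- The atomic proposition `APContains⟨c⟩` for `c ∈ {red, white, blue}`. -/
def containsAP : Color → AP
  | .red => AP.APContainsRed
  | .white => AP.APContainsWhite
  | .blue => AP.APContainsBlue
  | .empty => AP.APContainsRed  -- irrelevant: only used for c ∈ {red, white, blue}

/-- The small-step semantics `→_EC` of external commands, as a function. -/
def stepEC (e : ExtCom) (st : State) : State :=
  match st with
  | .Wrong => .Wrong
  | .Sigma b i =>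
    match e with
    | .IsFull => if baysFullB b then st else .Wrong
    | .NotFull => if baysFullB b then .Wrong else st
    | .HasColor => if containsC b (requestedColor i) then st else .Wrong
    | .DoesNotHaveColor => if containsC b (requestedColor i) then .Wrong else st
    | .Store c =>
      match findColor Color.empty 1 b with
      | some n => .Sigma (setBay b n c) i
      | none => .Wrong
    | .Retrieve c =>
      match findColor c 1 b with
      | some n => .Sigma (setBay b n Color.empty) i
      | none => .Wrong

/-- The labeled small-step semantics of internal commands: a step carries
`some e` when it executes the external command `e`, and `none` otherwise. -/
inductive StepL : IntCom × State → Option ExtCom → IntCom × State → Prop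
  | ext (e : ExtCom) (st : State) :
      StepL (.Ext e, st) (some e) (.Skip, stepEC e st)
  | seq_skip (t : IntCom) (st : State) :
      StepL (.Seq .Skip t, st) none (t, st)
  | seq_step {t1 t1' t2 : IntCom} {st st' : State} {l : Option ExtCom} :
      StepL (t1, st) l (t1', st') →
      StepL (.Seq t1 t2, st) l (.Seq t1' t2, st')
  | if_true {p : AP} {t1 t2 : IntCom} {st : State} :
      evalAtomicProp p st = true → StepL (.If p t1 t2, st) none (t1, st)
  | if_false {p : AP} {t1 t2 : IntCom} {st : State} :
      evalAtomicProp p st = false → StepL (.If p t1 t2, st) none (t2, st)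

/-- The small-step semantics `→_IC` of internal commands. -/
def StepIC (c c' : IntCom × State) : Prop := ∃ l, StepL c l c'

/-- `⟨t, σ⟩ ↝ ψ`: evaluation of `t` from `σ` reaches `⟨Skip, ψ⟩`. -/
def Evaluates (t : IntCom) (σ ψ : State) : Prop :=
  Relation.ReflTransGen StepIC (t, σ) (IntCom.Skip, ψ)

/-- `EmitsTo c tr c'`: configuration `c` multi-steps to `c'` executing exactly the
external commands of `tr`, in order. -/
inductive EmitsTo : IntCom × State → List ExtCom → IntCom × State → Prop
  | refl (c : IntCom × State) : EmitsTo c [] c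
  | step {c c' c'' : IntCom × State} {l : Option ExtCom} {tr : List ExtCom} :
      StepL c l c' → EmitsTo c' tr c'' → EmitsTo c (l.toList ++ tr) c''

/-- The protocol term `spec`. -/
def spec : IntCom :=
  .If .APHasStoreRequest
    (.If .APBaysFull (.Ext .IsFull)
      (.Seq (.Ext .NotFull)
        (.If .APRequestRed (.Ext (.Store .red))
          (.If .APRequestWhite (.Ext (.Store .white))
            (.If .APRequestBlue (.Ext (.Store .blue)) .Skip)))))
    (.If .APHasRetrieveRequest
      (.If .APRequestRed
        (.If .APContainsRed (.Seq (.Ext .HasColor) (.Ext (.Retrieve .red)))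
          (.Ext .DoesNotHaveColor))
        (.If .APRequestWhite
          (.If .APContainsWhite (.Seq (.Ext .HasColor) (.Ext (.Retrieve .white)))
            (.Ext .DoesNotHaveColor))
          (.If .APRequestBlue
            (.If .APContainsBlue (.Seq (.Ext .HasColor) (.Ext (.Retrieve .blue)))
              (.Ext .DoesNotHaveColor))
            .Skip)))
      .Skip)

/-- `Generates t σ tr`: the trace `tr` is generated by evaluating `t` from `σ`,
restarting `spec` in the resulting state whenever evaluation reaches `Skip`
(for as long as commands of `tr` remain). -/
inductive Generates : IntCom → State → List ExtCom → Prop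
  | nil (t : IntCom) (σ : State) : Generates t σ []
  | emit {t t' : IntCom} {σ σ' : State} {e : ExtCom} {tr : List ExtCom} :
      EmitsTo (t, σ) [e] (t', σ') → Generates t' σ' tr → Generates t σ (e :: tr)
  | restart {t : IntCom} {σ σ' : State} {tr : List ExtCom} :
      EmitsTo (t, σ) [] (.Skip, σ') → Generates spec σ' tr → Generates t σ tr

/-- Execute a list of external commands from a state. -/
def runTrace (st : State) : List ExtCom → State
  | [] => st
  | e :: tr => runTrace (stepEC e st) tr

/-- Evaluate an internal command from a state up to (and including) the next
external command, returning that command (or `none` if evaluation reaches `Skip`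
without executing one), the remaining internal command (or `none`), and the
resulting state. -/
def evalUntilNextCom (st : State) : IntCom → Option ExtCom × Option IntCom × State
  | .Skip => (none, none, st)
  | .Ext e => (some e, none, stepEC e st)
  | .Seq t1 t2 =>
    match evalUntilNextCom st t1 with
    | (none, _, st') => evalUntilNextCom st' t2
    | (some e, none, st') => (some e, some t2, st')
    | (some e, some t1', st') => (some e, some (.Seq t1' t2), st')
  | .If p t1 t2 => if evalAtomicProp p st then evalUntilNextCom st t1 else evalUntilNextCom st t2

/-- The trace decider. -/
def isTrace (t : IntCom) (tr : List ExtCom) (st : State) : Bool :=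
  match tr with
  | [] => true
  | com :: tr' =>
    match evalUntilNextCom st t with
    | (none, _, _) => false
    | (some com', none, st') => com = com' && isTrace spec tr' st'
    | (some com', some t', st') => com = com' && isTrace t' tr' st'
termination_by tr.length
decreasing_by all_goals simp

theorem bf_ne_of_findColor_eq_none {c : Color} {n : ℕ} {b : Bays}
    (h : findColor c n b = none) {m : ℕ} (hnm : n ≤ m) (hm : m ≤ 9) : bf b m ≠ c := by
  fun_induction findColor c n b with
  | case1 => simp at h
  | case2 n _ hne ih =>
    rcases hnm.eq_or_lt with rfl | hlt
    · exact hne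
    · exact ih h hlt
  | case3 => omega

theorem exists_findColor_eq_some {c : Color} {b : Bays} (h : containsC b c = true) :
    ∃ n, findColor c 1 b = some n := by
  rw [← Option.ne_none_iff_exists']
  intro hnone
  obtain ⟨m, hm, hc⟩ := List.any_eq_true.mp h
  rw [List.mem_range'_1] at hm
  exact bf_ne_of_findColor_eq_none hnone hm.1 (by omega) (by simpa using hc)

theorem containsC_empty (b : Bays) : containsC b Color.empty = !baysFullB b := by
  simp [containsC, baysFullB, List.any_eq_not_all_not]

/-- Big-step evaluation of internal commands. -/
def runIC : IntCom → State → State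
  | .Skip, st => st
  | .Seq t1 t2, st => runIC t2 (runIC t1 st)
  | .If p t1 t2, st => if evalAtomicProp p st then runIC t1 st else runIC t2 st
  | .Ext e, st => stepEC e st

theorem StepL.runIC_eq {c c' : IntCom × State} {l : Option ExtCom} (h : StepL c l c') :
    runIC c.1 c.2 = runIC c'.1 c'.2 := by
  induction h <;> simp_all [runIC]

theorem Evaluates.eq_runIC {t : IntCom} {σ ψ : State} (h : Evaluates t σ ψ) :
    ψ = runIC t σ := by
  have key : ∀ c c' : IntCom × State, Relation.ReflTransGen StepIC c c' →
      runIC c.1 c.2 = runIC c'.1 c'.2 := by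
    intro c c' hcc'
    induction hcc' with
    | refl => rfl
    | tail _ hstep ih =>
      obtain ⟨_, hl⟩ := hstep
      exact ih.trans hl.runIC_eq
  exact (key _ _ h).symm

theorem stepEC_store_ne_wrong {b : Bays} (i : Input) (c : Color) (h : baysFullB b = false) :
    stepEC (.Store c) (.Sigma b i) ≠ .Wrong := by
  obtain ⟨n, hn⟩ := exists_findColor_eq_some (b := b) (c := .empty) (by simp [containsC_empty, h])
  simp [stepEC, hn]

theorem stepEC_retrieve_ne_wrong {b : Bays} (i : Input) {c : Color} (h : containsC b c = true) :
    stepEC (.Retrieve c) (.Sigma b i) ≠ .Wrong := by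
  obtain ⟨n, hn⟩ := exists_findColor_eq_some h
  simp [stepEC, hn]

theorem stepEC_isFull {b : Bays} (i : Input) (h : baysFullB b = true) :
    stepEC .IsFull (.Sigma b i) = .Sigma b i := by
  simp [stepEC, h]

theorem stepEC_notFull {b : Bays} (i : Input) (h : baysFullB b = false) :
    stepEC .NotFull (.Sigma b i) = .Sigma b i := by
  simp [stepEC, h]

theorem stepEC_hasColor {b : Bays} {i : Input} (h : containsC b (requestedColor i) = true) :
    stepEC .HasColor (.Sigma b i) = .Sigma b i := by
  simp [stepEC, h]

theorem stepEC_doesNotHaveColor {b : Bays} {i : Input}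
    (h : containsC b (requestedColor i) = false) :
    stepEC .DoesNotHaveColor (.Sigma b i) = .Sigma b i := by
  simp [stepEC, h]

theorem runIC_spec_ne_wrong (b : Bays) (i : Input) : runIC spec (.Sigma b i) ≠ .Wrong := by
  cases i with
  | StoreRequest c =>
    cases hfull : baysFullB b <;> cases c <;>
      simp [spec, runIC, evalAtomicProp, evalAP, requestedColor, hfull, stepEC_isFull,
        stepEC_notFull, stepEC_store_ne_wrong]
  | RetrieveRequest c =>
    cases hc : containsC b c <;> cases c <;>
      simp [spec, runIC, evalAtomicProp, evalAP, requestedColor, hc, stepEC_hasColor,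
        stepEC_doesNotHaveColor, stepEC_retrieve_ne_wrong]

/-- For every state `σ ≠ Wrong`, evaluating `spec` from `σ`
never reaches the error state: `⟨spec, σ⟩ ↝̸ Wrong`. -/
theorem spec_never_goes_wrong (σ : State) (hσ : σ ≠ State.Wrong) :
    ¬ Evaluates spec σ State.Wrong := by
  cases σ with
  | Sigma b i => exact fun h => runIC_spec_ne_wrong b i h.eq_runIC.symm
  | Wrong => exact absurd rfl hσ
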